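/- Under the hypotheses of the previous context and assuming ∫_a^b |r(s)| ds > 0, the characteristic function F(λ) = y(b,λ)cos β + (p y')(b,λ)sin β does not vanish identically on ℂ; consequently the set of eigenvalues of the problem is a discrete subset of ℂ with no finite accumulation point. -/

import Mathlib

open MeasureTheory

/-- `y` together with its quasi-derivative `py = p·y'` is a solution (in the
absolutely continuous, Carathéodory sense) of `-(p y')' + q y = λ r y` on `[a,b]`. -/
def IsSLSolution (p q r : ℝ → ℝ) (a b : ℝ) (l : ℂ) (y py : ℝ → ℂ) : Prop :=
  (∀ x ∈ Set.Icc a b, y x = y a + ∫ t in a..x, py t / (p t : ℂ)) ∧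
  (∀ x ∈ Set.Icc a b, py x = py a + ∫ t in a..x, ((q t : ℂ) * y t - l * (r t : ℂ) * y t))

/-- `l` is an eigenvalue of the regular Sturm-Liouville problem with separated
boundary conditions determined by the angles `α, β`. -/
def IsEigenvalue (p q r : ℝ → ℝ) (a b α β : ℝ) (l : ℂ) : Prop :=
  ∃ y py : ℝ → ℂ, IsSLSolution p q r a b l y py ∧
    (∃ x ∈ Set.Icc a b, y x ≠ 0) ∧
    y a * (Real.cos α : ℂ) - py a * (Real.sin α : ℂ) = 0 ∧
    y b * (Real.cos β : ℂ) + py b * (Real.sin β : ℂ) = 0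


structure Prm (a b : ℝ) (f F : ℝ → ℂ) : Prop where
  int : IntervalIntegrable f volume a b
  eq : ∀ x ∈ Set.Icc a b, F x = F a + ∫ t in a..x, f t

theorem ac_of_dist_le {X Y : Type*} [PseudoMetricSpace X] [PseudoMetricSpace Y]
    {F : ℝ → X} {G : ℝ → Y} {a b : ℝ}
    (hG : AbsolutelyContinuousOnInterval G a b)
    (h : ∀ x ∈ Set.uIcc a b, ∀ y ∈ Set.uIcc a b, dist (F x) (F y) ≤ dist (G x) (G y)) :
    AbsolutelyContinuousOnInterval F a b := by
  rw [absolutelyContinuousOnInterval_iff] at hG ⊢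
  intro ε hε
  obtain ⟨δ, hδ, H⟩ := hG ε hε
  refine ⟨δ, hδ, fun E hE hs => lt_of_le_of_lt (Finset.sum_le_sum fun i hi => ?_) (H E hE hs)⟩
  exact h _ (hE.1 i hi).1 _ (hE.1 i hi).2

theorem Prm.sub {a b : ℝ} {f F : ℝ → ℂ} (h : Prm a b f F) {s t : ℝ}
    (hs : s ∈ Set.Icc a b) (ht : t ∈ Set.Icc a b) : F t - F s = ∫ x in s..t, f x := by
  have hi : ∀ x ∈ Set.Icc a b, IntervalIntegrable f volume a x := fun x hx =>
    h.int.mono_set (by rw [Set.uIcc_of_le hx.1, Set.uIcc_of_le (hx.1.trans hx.2)]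
                       exact Set.Icc_subset_Icc_right hx.2)
  rw [h.eq t ht, h.eq s hs, ← intervalIntegral.integral_interval_sub_left (hi t ht) (hi s hs)]
  ring

theorem Prm.ac {a b : ℝ} (hab : a ≤ b) {f F : ℝ → ℂ} (h : Prm a b f F) :
    AbsolutelyContinuousOnInterval F a b := by
  have hi := h.int.norm
  have hG := hi.absolutelyContinuousOnInterval_intervalIntegral (c := a) (by simp)
  refine ac_of_dist_le hG ?_
  rw [Set.uIcc_of_le hab]
  have hi' : ∀ x ∈ Set.Icc a b, IntervalIntegrable (fun t => ‖f t‖) volume a x := fun x hx =>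
    hi.mono_set (by rw [Set.uIcc_of_le hx.1, Set.uIcc_of_le (hx.1.trans hx.2)]
                    exact Set.Icc_subset_Icc_right hx.2)
  intro x hx y hy
  rw [dist_comm (F x), dist_comm (∫ t in a..x, ‖f t‖), dist_eq_norm, h.sub hx hy, Real.dist_eq,
    intervalIntegral.integral_interval_sub_left (hi' y hy) (hi' x hx)]
  exact intervalIntegral.norm_integral_le_abs_integral_norm

theorem Prm.cont {a b : ℝ} (hab : a ≤ b) {f F : ℝ → ℂ} (h : Prm a b f F) :
    ContinuousOn F (Set.Icc a b) := by
  have := (h.ac hab).continuousOn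
  rwa [Set.uIcc_of_le hab] at this

theorem Prm.deriv {a b : ℝ} (hab : a ≤ b) {f F : ℝ → ℂ} (h : Prm a b f F) :
    ∀ᵐ x, x ∈ Set.Icc a b → HasDerivAt F (f x) x := by
  have h₁ : ∀ᵐ x : ℝ, x ≠ a := by simp [ae_iff, measure_singleton]
  have h₂ : ∀ᵐ x : ℝ, x ≠ b := by simp [ae_iff, measure_singleton]
  filter_upwards [h.int.ae_hasDerivAt_integral, h₁, h₂] with x hx hxa hxb hxI
  have hxo : x ∈ Set.Ioo a b := ⟨lt_of_le_of_ne hxI.1 (Ne.symm hxa), lt_of_le_of_ne hxI.2 hxb⟩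
  have := (hx (by rwa [Set.uIcc_of_le hab]) a (by simp)).const_add (F a)
  refine this.congr_of_eventuallyEq ?_
  filter_upwards [Icc_mem_nhds hxo.1 hxo.2] with y hy
  exact h.eq y hy

theorem Prm.mul {a b : ℝ} (hab : a ≤ b) {f F g G : ℝ → ℂ} (hF : Prm a b f F) (hG : Prm a b g G) :
    Prm a b (fun x => f x * G x + F x * g x) (fun x => F x * G x) := by
  have cF : ContinuousOn F (Set.uIcc a b) := (hF.ac hab).continuousOn
  have cG : ContinuousOn G (Set.uIcc a b) := (hG.ac hab).continuousOn
  have hfgI : IntervalIntegrable (fun x => f x * G x + F x * g x) volume a b :=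
    (hF.int.mul_continuousOn cG).add (hG.int.continuousOn_mul cF)
  refine ⟨hfgI, ?_⟩
  have hP : Prm a b (fun x => f x * G x + F x * g x)
    (fun x => ∫ t in a..x, (f t * G t + F t * g t)) := ⟨hfgI, by simp⟩
  have acP := hP.ac hab
  have acM : AbsolutelyContinuousOnInterval (fun x => F x * G x) a b := by
    have := (hF.ac hab).smul (hG.ac hab)
    exact this
  have acD := acM.sub acP
  obtain ⟨C, hC⟩ := acD.const_of_ae_hasDerivAt_zero (by
    filter_upwards [hF.deriv hab, hG.deriv hab, hP.deriv hab] with x h1 h2 h3 hx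
    rw [Set.uIcc_of_le hab] at hx
    have := ((h1 hx).mul (h2 hx)).sub (h3 hx)
    rw [sub_self] at this
    exact this)
  intro x hx
  have e1 := hC x (by rwa [Set.uIcc_of_le hab])
  have e2 := hC a (by simp)
  simp only [Pi.sub_apply, intervalIntegral.integral_same] at e1 e2
  linear_combination e1 - e2

theorem Prm.zero {a b : ℝ} (hab : a ≤ b) {f F : ℝ → ℂ} (h : Prm a b f F) :
    ∀ᵐ x, x ∈ Set.Icc a b → F x = 0 → f x = 0 := by
  have hc : {x ∈ {x | F x = 0} | nhdsWithin x ({x | F x = 0} ∩ Set.Ioi x) = ⊥}.Countable :=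
    countable_setOfPred_isolated_right_within
  filter_upwards [h.deriv hab, hc.ae_notMem volume] with x hx hn hxI hF
  have hd := hx hxI
  have hne : (nhdsWithin x ({x | F x = 0} ∩ Set.Ioi x)).NeBot := by
    constructor
    intro hbot
    exact hn ⟨hF, hbot⟩
  have hd' := hd.hasDerivWithinAt (s := {x | F x = 0} ∩ Set.Ioi x)
  rw [hasDerivWithinAt_iff_tendsto_slope' (by simp)] at hd'
  refine tendsto_nhds_unique hd' ?_
  refine (tendsto_const_nhds (x := (0:ℂ))).congr' ?_
  filter_upwards [self_mem_nhdsWithin] with y hy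
  have h1 : F y = 0 := hy.1
  have h2 : F x = 0 := hF
  simp [slope, h1, h2]

theorem Prm.conj {a b : ℝ} {f F : ℝ → ℂ} (h : Prm a b f F) :
    Prm a b (fun x => (starRingEnd ℂ) (f x)) (fun x => (starRingEnd ℂ) (F x)) := by
  have hi : IntervalIntegrable (fun x => (starRingEnd ℂ) (f x)) volume a b :=
    ⟨(Complex.conjCLE.toContinuousLinearMap.integrable_comp h.int.1),
      (Complex.conjCLE.toContinuousLinearMap.integrable_comp h.int.2)⟩
  refine ⟨hi, fun x hx => ?_⟩
  have hfx : IntervalIntegrable f volume a x :=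
    h.int.mono_set (by rw [Set.uIcc_of_le hx.1, Set.uIcc_of_le (hx.1.trans hx.2)]
                       exact Set.Icc_subset_Icc_right hx.2)
  have := Complex.conjCLE.toContinuousLinearMap.intervalIntegral_comp_comm hfx
  simp at this
  rw [this, h.eq x hx]
  simp

theorem Prm.sum {ι : Type*} {a b : ℝ} (s : Finset ι) (c : ι → ℂ) {f F : ι → ℝ → ℂ}
    (h : ∀ i ∈ s, Prm a b (f i) (F i)) :
    Prm a b (fun x => ∑ i ∈ s, c i * f i x) (fun x => ∑ i ∈ s, c i * F i x) := by
  refine ⟨?_, fun x hx => ?_⟩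
  · have := IntervalIntegrable.sum s (f := fun i x => c i * f i x) (fun i hi => (h i hi).int.const_mul (c i))
    have e : (fun x => ∑ i ∈ s, c i * f i x) = ∑ i ∈ s, (fun x => c i * f i x) := by
      ext x; simp
    rw [e]
    exact this
  have hfx : ∀ i ∈ s, IntervalIntegrable (fun t => c i * f i t) volume a x := fun i hi =>
    ((h i hi).int.mono_set (by rw [Set.uIcc_of_le hx.1, Set.uIcc_of_le (hx.1.trans hx.2)]
                               exact Set.Icc_subset_Icc_right hx.2)).const_mul (c i)
  rw [intervalIntegral.integral_finsetSum hfx, ← Finset.sum_add_distrib]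
  refine Finset.sum_congr rfl fun i hi => ?_
  rw [intervalIntegral.integral_const_mul, (h i hi).eq x hx]
  ring

theorem Prm.mono {a b : ℝ} {f F : ℝ → ℂ} (h : Prm a b f F) {s t : ℝ} (hs : a ≤ s) (hst : s ≤ t)
    (ht : t ≤ b) : Prm s t f F := by
  refine ⟨h.int.mono_set ?_, fun x hx => ?_⟩
  · rw [Set.uIcc_of_le hst, Set.uIcc_of_le (hs.trans (hst.trans ht))]
    exact Set.Icc_subset_Icc hs ht
  · rw [← h.sub ⟨hs, hst.trans ht⟩ ⟨hs.trans hx.1, hx.2.trans ht⟩]; ring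


theorem exp_ac {a b : ℝ} {K : ℝ → ℝ} (hK : AbsolutelyContinuousOnInterval K a b) :
    AbsolutelyContinuousOnInterval (fun x => Real.exp (K x)) a b := by
  obtain ⟨M, hM⟩ := hK.exists_bound
  refine ac_of_dist_le (hK.const_mul (Real.exp M)) ?_
  have key : ∀ s t : ℝ, s ≤ M → Real.exp s - Real.exp t ≤ Real.exp M * |s - t| := by
    intro s t hs
    have h1 := Real.add_one_le_exp (t - s)
    have h2 : Real.exp t = Real.exp s * Real.exp (t - s) := by rw [← Real.exp_add]; ring_nf
    have h3 := Real.exp_le_exp.mpr hs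
    have h4 := Real.exp_pos s
    calc Real.exp s - Real.exp t ≤ Real.exp s * (s - t) := by rw [h2]; nlinarith
      _ ≤ Real.exp s * |s - t| := by gcongr; exact le_abs_self _
      _ ≤ _ := by gcongr
  intro x hx y hy
  have hx' := (le_abs_self _).trans (hM x hx)
  have hy' := (le_abs_self _).trans (hM y hy)
  have k1 := key _ (K y) hx'
  have k2 := key _ (K x) hy'
  rw [abs_sub_comm] at k2
  rw [Real.dist_eq, Real.dist_eq]
  have : (fun x => Real.exp M * K x) x - (fun x => Real.exp M * K x) y = Real.exp M * (K x - K y) := by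
    simp; ring
  show _ ≤ |(Real.exp M * K x) - (Real.exp M * K y)|
  rw [← mul_sub, abs_mul, abs_of_pos (Real.exp_pos M)]
  exact abs_le.mpr ⟨by linarith, by linarith⟩

theorem ac_nonneg_deriv {a b : ℝ} (hab : a ≤ b) {N n : ℝ → ℝ}
    (hN : AbsolutelyContinuousOnInterval N a b)
    (hd : ∀ᵐ x, x ∈ Set.Icc a b → HasDerivAt N (n x) x)
    (hn : ∀ᵐ x, x ∈ Set.Icc a b → 0 ≤ n x) {s t : ℝ} (hs : a ≤ s) (hst : s ≤ t) (ht : t ≤ b) :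
    N s ≤ N t := by
  have hsub : Set.Icc s t ⊆ Set.Icc a b := Set.Icc_subset_Icc hs ht
  have h := (hN.mono (c := s) (d := t) (by
    rwa [Set.uIcc_of_le hst, Set.uIcc_of_le hab])).integral_deriv_eq_sub
  have : 0 ≤ ∫ x in s..t, deriv N x := by
    apply intervalIntegral.integral_nonneg_of_ae_restrict hst
    rw [Filter.EventuallyLE, ae_restrict_iff' measurableSet_Icc]
    filter_upwards [hd, hn] with x h1 h2 hx
    rw [(h1 (hsub hx)).deriv]
    exact h2 (hsub hx)
  linarith

theorem ac_gronwall {a b : ℝ} (hab : a ≤ b) {N n k : ℝ → ℝ}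
    (hN : AbsolutelyContinuousOnInterval N a b)
    (hN0 : ∀ x, 0 ≤ N x)
    (hk : IntervalIntegrable k volume a b)
    (hk0 : ∀ᵐ x, x ∈ Set.Icc a b → 0 ≤ k x)
    (hd : ∀ᵐ x, x ∈ Set.Icc a b → HasDerivAt N (n x) x)
    (hn : ∀ᵐ x, x ∈ Set.Icc a b → |n x| ≤ k x * N x) {s t : ℝ}
    (hs : s ∈ Set.Icc a b) (ht : t ∈ Set.Icc a b) :
    N t ≤ N s * Real.exp (∫ x in a..b, k x) := by
  set K : ℝ → ℝ := fun x => ∫ t in a..x, k t with hKdef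
  have hK : AbsolutelyContinuousOnInterval K a b :=
    hk.absolutelyContinuousOnInterval_intervalIntegral (c := a) (by simp)
  have hKd : ∀ᵐ x, x ∈ Set.Icc a b → HasDerivAt K (k x) x := by
    filter_upwards [hk.ae_hasDerivAt_integral] with x hx hxI
    exact hx (by rwa [Set.uIcc_of_le hab]) a (by simp)
  have hKm : ∀ {s t : ℝ}, a ≤ s → s ≤ t → t ≤ b → K s ≤ K t := fun h1 h2 h3 =>
    ac_nonneg_deriv hab hK hKd hk0 h1 h2 h3
  have hKa : K a = 0 := by simp [hKdef]
  have hdiff : ∀ s ∈ Set.Icc a b, ∀ t ∈ Set.Icc a b, K t - K s ≤ K b := by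
    intro s hs t ht
    have := hKm le_rfl hs.1 hs.2
    have := hKm ht.1 ht.2 le_rfl
    linarith
  show N t ≤ N s * Real.exp (K b)
  rcases le_total s t with hst | hst
  · -- N exp(-K) nonincreasing
    have hac : AbsolutelyContinuousOnInterval (fun x => (-1) * (N x * Real.exp ((-1) * K x))) a b :=
      (hN.mul (exp_ac (hK.const_mul (-1)))).const_mul (-1)
    have := ac_nonneg_deriv hab hac
      (n := fun x => (-1) * (n x * Real.exp ((-1) * K x) +
        N x * (Real.exp ((-1) * K x) * ((-1) * k x)))) (by
      filter_upwards [hd, hKd] with x h1 h2 hx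
      exact (((h1 hx)).mul (((h2 hx).const_mul (-1)).exp)).const_mul (-1)) (by
      filter_upwards [hn] with x h1 hx
      have h2 := (le_abs_self _).trans (h1 hx)
      have : (-1) * (n x * Real.exp ((-1) * K x) +
        N x * (Real.exp ((-1) * K x) * ((-1) * k x))) =
        Real.exp ((-1) * K x) * (k x * N x - n x) := by ring
      rw [this]
      exact mul_nonneg (Real.exp_pos _).le (by linarith)) hs.1 hst ht.2
    have h1 : N t * Real.exp ((-1) * K t) ≤ N s * Real.exp ((-1) * K s) := by linarith
    have h2 : N t ≤ N s * Real.exp (K t - K s) := by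
      have := mul_le_mul_of_nonneg_right h1 (Real.exp_pos (K t)).le
      rw [mul_assoc, mul_assoc, ← Real.exp_add, ← Real.exp_add] at this
      ring_nf at this
      rw [Real.exp_zero] at this
      ring_nf
      linarith
    exact h2.trans (mul_le_mul_of_nonneg_left (Real.exp_le_exp.mpr (hdiff s hs t ht)) (hN0 s))
  · have hac : AbsolutelyContinuousOnInterval (fun x => (N x * Real.exp (K x))) a b :=
      (hN.mul (exp_ac hK))
    have := ac_nonneg_deriv hab hac
      (n := fun x => (n x * Real.exp (K x) +
        N x * (Real.exp (K x) * (k x)))) (by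
      filter_upwards [hd, hKd] with x h1 h2 hx
      exact (((h1 hx)).mul (((h2 hx)).exp))) (by
      filter_upwards [hn] with x h1 hx
      have h2 := (abs_le.mp (h1 hx)).1
      have : (n x * Real.exp (K x) +
        N x * (Real.exp (K x) * (k x))) =
        Real.exp (K x) * (k x * N x + n x) := by ring
      rw [this]
      exact mul_nonneg (Real.exp_pos _).le (by linarith)) ht.1 hst hs.2
    have h1 : N t * Real.exp (K t) ≤ N s * Real.exp (K s) := this
    have h2 : N t ≤ N s * Real.exp (K s - K t) := by
      have := mul_le_mul_of_nonneg_right h1 (Real.exp_pos (-K t)).le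
      rw [mul_assoc, mul_assoc, ← Real.exp_add, ← Real.exp_add, add_neg_cancel, Real.exp_zero,
        mul_one, ← sub_eq_add_neg] at this
      exact this
    exact h2.trans (mul_le_mul_of_nonneg_left (Real.exp_le_exp.mpr (hdiff t ht s hs)) (hN0 s))

theorem Prm.energy {a b : ℝ} (hab : a ≤ b) {f F g G : ℝ → ℂ} {k : ℝ → ℝ}
    (hF : Prm a b f F) (hG : Prm a b g G)
    (hk : IntervalIntegrable k volume a b)
    (hk0 : ∀ᵐ x, x ∈ Set.Icc a b → 0 ≤ k x)
    (hf : ∀ᵐ x, x ∈ Set.Icc a b → ‖f x‖ ≤ k x * ‖G x‖)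
    (hg : ∀ᵐ x, x ∈ Set.Icc a b → ‖g x‖ ≤ k x * ‖F x‖) {s t : ℝ}
    (hs : s ∈ Set.Icc a b) (ht : t ∈ Set.Icc a b) :
    ‖F t‖ ^ 2 + ‖G t‖ ^ 2 ≤ (‖F s‖ ^ 2 + ‖G s‖ ^ 2) * Real.exp (∫ x in a..b, 2 * k x) := by
  have acn : ∀ {H : ℝ → ℂ}, AbsolutelyContinuousOnInterval H a b →
      AbsolutelyContinuousOnInterval (fun x => ‖H x‖ ^ 2) a b := by
    intro H hH
    have h1 : AbsolutelyContinuousOnInterval (fun x => ‖H x‖) a b := by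
      refine ac_of_dist_le hH fun x _ y _ => ?_
      rw [Real.dist_eq, dist_eq_norm]
      exact abs_norm_sub_norm_le _ _
    have h2 := h1.mul h1
    have e : (fun x => ‖H x‖ ^ 2) = (fun x => ‖H x‖) * (fun x => ‖H x‖) := by
      ext x; simp [sq]
    rw [e]; exact h2
  have hN : AbsolutelyContinuousOnInterval (fun x => ‖F x‖ ^ 2 + ‖G x‖ ^ 2) a b :=
    (acn (hF.ac hab)).add (acn (hG.ac hab))
  have hd : ∀ᵐ x, x ∈ Set.Icc a b → HasDerivAt (fun x => ‖F x‖ ^ 2 + ‖G x‖ ^ 2)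
      (2 * inner ℝ (F x) (f x) + 2 * inner ℝ (G x) (g x)) x := by
    filter_upwards [hF.deriv hab, hG.deriv hab] with x h1 h2 hx
    exact (h1 hx).norm_sq.add (h2 hx).norm_sq
  have hk2 : ∀ᵐ x, x ∈ Set.Icc a b → 0 ≤ 2 * k x := by
    filter_upwards [hk0] with x hx hI
    have := hx hI
    positivity
  have hn : ∀ᵐ x, x ∈ Set.Icc a b → |2 * inner ℝ (F x) (f x) + 2 * inner ℝ (G x) (g x)| ≤
      2 * k x * (‖F x‖ ^ 2 + ‖G x‖ ^ 2) := by
    filter_upwards [hf, hg, hk0] with x h1 h2 h3 hx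
    have i1 := abs_real_inner_le_norm (F x) (f x)
    have i2 := abs_real_inner_le_norm (G x) (g x)
    have j1 := mul_le_mul_of_nonneg_left (h1 hx) (norm_nonneg (F x))
    have j2 := mul_le_mul_of_nonneg_left (h2 hx) (norm_nonneg (G x))
    have i3 := abs_add_le (2 * inner ℝ (F x) (f x)) (2 * inner ℝ (G x) (g x))
    rw [abs_mul, abs_mul, abs_two] at i3
    have : 4 * (k x * (‖F x‖ * ‖G x‖)) ≤ 2 * k x * (‖F x‖ ^ 2 + ‖G x‖ ^ 2) := by
      have := mul_nonneg (h3 hx) (sq_nonneg (‖F x‖ - ‖G x‖))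
      nlinarith
    linarith
  exact ac_gronwall hab hN (fun x => by positivity) (hk.const_mul 2) hk2 hd hn hs ht


theorem sl_energy {p q r : ℝ → ℝ} {a b : ℝ} {l : ℂ} {y py : ℝ → ℂ}
    (hq : IntegrableOn q (Set.Icc a b)) (hr : IntegrableOn r (Set.Icc a b))
    (hip : IntegrableOn (fun x => (p x)⁻¹) (Set.Icc a b)) {x : ℝ} (hx : x ∈ Set.Icc a b)
    (h1 : Prm a x (fun t => py t / (p t : ℂ)) y)
    (h2 : Prm a x (fun t => (q t : ℂ) * y t - l * (r t : ℂ) * y t) py) {s t : ℝ}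
    (hs : s ∈ Set.Icc a x) (ht : t ∈ Set.Icc a x) :
    ‖y t‖ ^ 2 + ‖py t‖ ^ 2 ≤ (‖y s‖ ^ 2 + ‖py s‖ ^ 2) *
      Real.exp (∫ u in a..b, 2 * (|(p u)⁻¹| + |q u| + ‖l‖ * |r u|)) := by
  have hab := hx.1.trans hx.2
  have hI : IntegrableOn (fun u => |(p u)⁻¹| + |q u| + ‖l‖ * |r u|) (Set.Icc a b) :=
    (hip.abs.add hq.abs).add (hr.abs.const_mul ‖l‖)
  have hkb : IntervalIntegrable (fun u => |(p u)⁻¹| + |q u| + ‖l‖ * |r u|) volume a b :=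
    (intervalIntegrable_iff_integrableOn_Icc_of_le hab).mpr hI
  have hk : IntervalIntegrable (fun u => |(p u)⁻¹| + |q u| + ‖l‖ * |r u|) volume a x :=
    hkb.mono_set (by rw [Set.uIcc_of_le hx.1, Set.uIcc_of_le hab]
                     exact Set.Icc_subset_Icc_right hx.2)
  refine (Prm.energy hx.1 h1 h2 hk ?_ ?_ ?_ hs ht).trans ?_
  · exact Filter.Eventually.of_forall fun u _ => by positivity
  · refine Filter.Eventually.of_forall fun u _ => ?_
    rw [div_eq_mul_inv, norm_mul, norm_inv, Complex.norm_real, mul_comm, Real.norm_eq_abs, ← abs_inv]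
    gcongr
    have : 0 ≤ |q u| + ‖l‖ * |r u| := by positivity
    linarith
  · refine Filter.Eventually.of_forall fun u _ => ?_
    rw [← sub_mul, norm_mul]
    gcongr
    refine (norm_sub_le _ _).trans ?_
    rw [norm_mul, Complex.norm_real, Complex.norm_real, Real.norm_eq_abs, Real.norm_eq_abs]
    have : 0 ≤ |(p u)⁻¹| := by positivity
    linarith
  · gcongr
    apply intervalIntegral.integral_mono_interval le_rfl hx.1 hx.2
    · exact Filter.Eventually.of_forall fun u => by
        show (0:ℝ) ≤ _
        positivity
    · exact hkb.const_mul 2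

theorem sl_regular {p q r : ℝ → ℝ} {a b : ℝ} (hab : a ≤ b) {l : ℂ} {y py : ℝ → ℂ}
    (hq : IntegrableOn q (Set.Icc a b)) (hr : IntegrableOn r (Set.Icc a b))
    (hip : IntegrableOn (fun x => (p x)⁻¹) (Set.Icc a b))
    (h : IsSLSolution p q r a b l y py) :
    Prm a b (fun t => py t / (p t : ℂ)) y ∧
    Prm a b (fun t => (q t : ℂ) * y t - l * (r t : ℂ) * y t) py := by
  obtain ⟨e1, e2⟩ := h
  set f : ℝ → ℂ := fun t => py t / (p t : ℂ) with hf
  set g : ℝ → ℂ := fun t => (q t : ℂ) * y t - l * (r t : ℂ) * y t with hg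
  have hipC : IntegrableOn (fun x => (((p x)⁻¹ : ℝ) : ℂ)) (Set.Icc a b) := hip.ofReal
  have hqC : IntegrableOn (fun x => (q x : ℂ) - l * (r x : ℂ)) (Set.Icc a b) :=
    hq.ofReal.sub (hr.ofReal.const_mul l)
  have hfe : f = fun t => (((p t)⁻¹ : ℝ) : ℂ) * py t := by
    ext t; simp [hf, div_eq_mul_inv, mul_comm]
  have hge : g = fun t => ((q t : ℂ) - l * (r t : ℂ)) * y t := by
    ext t; simp [hg]; ring
  have P1 : ∀ x ∈ Set.Icc a b, IntervalIntegrable f volume a x → Prm a x f y := fun x hx hi =>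
    ⟨hi, fun t ht => e1 t ⟨ht.1, ht.2.trans hx.2⟩⟩
  have P2 : ∀ x ∈ Set.Icc a b, IntervalIntegrable g volume a x → Prm a x g py := fun x hx hi =>
    ⟨hi, fun t ht => e2 t ⟨ht.1, ht.2.trans hx.2⟩⟩
  have i12 : ∀ x ∈ Set.Icc a b, IntervalIntegrable f volume a x → IntervalIntegrable g volume a x := by
    intro x hx hi
    have hc := (P1 x hx hi).cont hx.1
    rw [hge]
    refine IntervalIntegrable.mul_continuousOn ?_ (by rwa [Set.uIcc_of_le hx.1])
    exact (intervalIntegrable_iff_integrableOn_Icc_of_le hx.1).mpr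
      (hqC.mono_set (Set.Icc_subset_Icc_right hx.2))
  have i21 : ∀ x ∈ Set.Icc a b, IntervalIntegrable g volume a x → IntervalIntegrable f volume a x := by
    intro x hx hi
    have hc := (P2 x hx hi).cont hx.1
    rw [hfe]
    refine IntervalIntegrable.mul_continuousOn ?_ (by rwa [Set.uIcc_of_le hx.1])
    exact (intervalIntegrable_iff_integrableOn_Icc_of_le hx.1).mpr
      (hipC.mono_set (Set.Icc_subset_Icc_right hx.2))
  suffices hS : IntervalIntegrable f volume a b from
    ⟨P1 b ⟨hab, le_rfl⟩ hS, P2 b ⟨hab, le_rfl⟩ (i12 b ⟨hab, le_rfl⟩ hS)⟩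
  obtain ⟨B, hB⟩ : ∃ B : ℝ, ∀ x ∈ Set.Icc a b, ‖py x‖ ^ 2 ≤ B := by
    refine ⟨(‖y a‖ ^ 2 + ‖py a‖ ^ 2) *
      Real.exp (∫ u in a..b, 2 * (|(p u)⁻¹| + |q u| + ‖l‖ * |r u|)), fun x hx => ?_⟩
    by_cases hx1 : IntervalIntegrable g volume a x
    · have := sl_energy hq hr hip hx (P1 x hx (i21 x hx hx1)) (P2 x hx hx1)
        (s := a) (t := x) ⟨le_rfl, hx.1⟩ ⟨hx.1, le_rfl⟩
      have := sq_nonneg ‖y x‖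
      linarith
    · rw [e2 x hx, intervalIntegral.integral_undef hx1, add_zero]
      have h1 : (1:ℝ) ≤ Real.exp (∫ u in a..b, 2 * (|(p u)⁻¹| + |q u| + ‖l‖ * |r u|)) := by
        apply Real.one_le_exp
        apply intervalIntegral.integral_nonneg hab
        intro u _; positivity
      have h2 := sq_nonneg ‖y a‖
      have h3 : 0 ≤ ‖y a‖ ^ 2 + ‖py a‖ ^ 2 := by positivity
      nlinarith
  set T : Set ℝ := {x | x ∈ Set.Icc a b ∧ IntervalIntegrable g volume a x} with hT
  have haT : a ∈ T := ⟨⟨le_rfl, hab⟩, by simp⟩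
  have hTb : BddAbove T := ⟨b, fun x hx => hx.1.2⟩
  set c := sSup T with hc
  have hac : a ≤ c := le_csSup hTb haT
  have hcb : c ≤ b := csSup_le ⟨a, haT⟩ fun x hx => hx.1.2
  have hcont : ContinuousOn py (Set.Ico a c) := by
    intro x hx
    obtain ⟨x', hx', hlt⟩ := exists_lt_of_lt_csSup ⟨a, haT⟩ hx.2
    have := (P2 x' hx'.1 hx'.2).cont hx'.1.1 x ⟨hx.1, hlt.le⟩
    refine this.mono_of_mem_nhdsWithin ?_
    filter_upwards [self_mem_nhdsWithin, mem_nhdsWithin_of_mem_nhds (Iio_mem_nhds hlt)] with z hz hz'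
    exact ⟨hz.1, le_of_lt hz'⟩
  have I1 : IntegrableOn f (Set.Ico a c) := by
    rw [hfe]
    have hb : IntegrableOn (fun x => (((p x)⁻¹ : ℝ) : ℂ)) (Set.Ico a c) :=
      hipC.mono_set (fun x hx => ⟨hx.1, hx.2.le.trans hcb⟩)
    refine Integrable.mul_bdd (c := Real.sqrt B) hb (hcont.aestronglyMeasurable measurableSet_Ico) ?_
    rw [ae_restrict_iff' measurableSet_Ico]
    refine Filter.Eventually.of_forall fun x hx => ?_
    exact Real.le_sqrt_of_sq_le (hB x ⟨hx.1, hx.2.le.trans hcb⟩)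
  have I2 : IntegrableOn f (Set.Ioc c b) := by
    have hb : IntegrableOn (fun x => (((p x)⁻¹ : ℝ) : ℂ) * py a) (Set.Ioc c b) :=
      (hipC.mono_set (fun x hx => ⟨hac.trans hx.1.le, hx.2⟩)).mul_const _
    refine hb.congr_fun (fun x hx => ?_) measurableSet_Ioc
    have hxI : x ∈ Set.Icc a b := ⟨hac.trans hx.1.le, hx.2⟩
    have : ¬ IntervalIntegrable g volume a x := fun hi => by
      have := le_csSup hTb (show x ∈ T from ⟨hxI, hi⟩)
      exact absurd hx.1 (not_lt.mpr this)
    rw [hfe]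
    simp only
    rw [e2 x hxI, intervalIntegral.integral_undef this, add_zero]
  have I3 : IntegrableOn f {c} := integrableOn_singleton (by simp) (by rw [Real.volume_singleton]; simp)
  rw [intervalIntegrable_iff_integrableOn_Icc_of_le hab]
  refine ((I1.union I3).union I2).mono_set fun x hx => ?_
  rcases lt_trichotomy x c with h | h | h
  · exact Or.inl (Or.inl ⟨hx.1, h⟩)
  · exact Or.inl (Or.inr h)
  · exact Or.inr ⟨h, hx.2⟩


theorem sl_ae_ne {p q r : ℝ → ℝ} {a b : ℝ} (hab : a ≤ b) {l : ℂ} {y py : ℝ → ℂ}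
    (hp : ∀ᵐ x, x ∈ Set.Icc a b → 0 < p x)
    (hq : IntegrableOn q (Set.Icc a b)) (hr : IntegrableOn r (Set.Icc a b))
    (hip : IntegrableOn (fun x => (p x)⁻¹) (Set.Icc a b))
    (h1 : Prm a b (fun t => py t / (p t : ℂ)) y)
    (h2 : Prm a b (fun t => (q t : ℂ) * y t - l * (r t : ℂ) * y t) py)
    (hne : ∃ x ∈ Set.Icc a b, y x ≠ 0) :
    ∀ᵐ x, x ∈ Set.Icc a b → y x ≠ 0 := by
  obtain ⟨x0, hx0, hy0⟩ := hne
  filter_upwards [hp, h1.zero hab] with x hpx hz hx hyx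
  have h3 := hz hx hyx
  have h4 : py x = 0 := by
    rcases div_eq_zero_iff.mp h3 with h | h
    · exact h
    · exact absurd (by exact_mod_cast h) (hpx hx).ne'
  have := sl_energy hq hr hip ⟨hab, le_rfl⟩ h1 h2 hx hx0
  rw [hyx, h4] at this
  have h5 : 0 < ‖y x0‖ := norm_pos_iff.mpr hy0
  simp at this
  nlinarith [sq_nonneg ‖py x0‖]

theorem sl_indep {p q r : ℝ → ℝ} {a b : ℝ} (hab : a ≤ b) {ι : Type*} [DecidableEq ι]
    {lam : ι → ℂ} {y py : ι → ℝ → ℂ}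
    (hp : ∀ᵐ x, x ∈ Set.Icc a b → 0 < p x)
    (hlam : Function.Injective lam)
    (h1 : ∀ i, Prm a b (fun t => py i t / (p t : ℂ)) (y i))
    (h2 : ∀ i, Prm a b (fun t => (q t : ℂ) * y i t - lam i * (r t : ℂ) * y i t) (py i))
    (s : Finset ι) :
    ∀ c : ι → ℂ, (∀ᵐ x, x ∈ Set.Icc a b → (r x : ℂ) * ∑ i ∈ s, c i * y i x = 0) →
      ∀ i ∈ s, c i ≠ 0 → ∀ᵐ x, x ∈ Set.Icc a b → (r x : ℂ) * y i x = 0 := by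
  induction s using Finset.induction_on with
  | empty => intro c _ i hi; simp at hi
  | insert m s hm ih =>
    intro c hc
    have z1 := (Prm.sum (insert m s) c fun i _ => h1 i).zero hab
    have z2 := (Prm.sum (insert m s) c fun i _ => h2 i).zero hab
    have key : ∀ᵐ x, x ∈ Set.Icc a b →
        (r x : ℂ) * ∑ i ∈ insert m s, c i * lam i * y i x = 0 := by
      filter_upwards [z1, z2, hc, hp] with x k1 k2 k3 k4 hx
      rcases mul_eq_zero.mp (k3 hx) with h | h
      · rw [h, zero_mul]
      · have e1 := k1 hx h
        have e2 : ∑ i ∈ insert m s, c i * py i x = 0 := by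
          have hpx : (p x : ℂ) ≠ 0 := by exact_mod_cast (k4 hx).ne'
          have : (∑ i ∈ insert m s, c i * py i x) / (p x : ℂ) = 0 := by
            rw [← e1, Finset.sum_div]
            exact Finset.sum_congr rfl fun i _ => by ring
          rcases div_eq_zero_iff.mp this with h | h
          · exact h
          · exact absurd h hpx
        have e3 := k2 hx e2
        have e4 : ∑ i ∈ insert m s, c i * ((q x : ℂ) * y i x - lam i * (r x : ℂ) * y i x) =
          (q x : ℂ) * (∑ i ∈ insert m s, c i * y i x) -
            (r x : ℂ) * ∑ i ∈ insert m s, c i * lam i * y i x := by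
          rw [Finset.mul_sum, Finset.mul_sum, ← Finset.sum_sub_distrib]
          exact Finset.sum_congr rfl fun i _ => by ring
        rw [e4, h] at e3
        linear_combination -e3
    have key2 : ∀ᵐ x, x ∈ Set.Icc a b →
        (r x : ℂ) * ∑ i ∈ s, (c i * (lam i - lam m)) * y i x = 0 := by
      filter_upwards [key, hc] with x k1 k2 hx
      have k1 := k1 hx
      have k2 := k2 hx
      rw [Finset.sum_insert hm] at k1 k2
      have : ∑ i ∈ s, (c i * (lam i - lam m)) * y i x =
          ∑ i ∈ s, c i * lam i * y i x - lam m * ∑ i ∈ s, c i * y i x := by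
        rw [Finset.mul_sum, ← Finset.sum_sub_distrib]
        exact Finset.sum_congr rfl fun i _ => by ring
      rw [this]
      linear_combination k1 - lam m * k2
    have hs : ∀ i ∈ s, c i ≠ 0 → ∀ᵐ x, x ∈ Set.Icc a b → (r x : ℂ) * y i x = 0 := by
      intro i hi hci
      refine ih _ key2 i hi (mul_ne_zero hci (sub_ne_zero.mpr fun h => ?_))
      exact hm (hlam h ▸ hi)
    intro i hi hci
    rcases Finset.mem_insert.mp hi with rfl | hi'
    · have hall : ∀ᵐ x, ∀ j ∈ s, x ∈ Set.Icc a b → (r x : ℂ) * (c j * y j x) = 0 := by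
        rw [Filter.eventually_all_finset]
        intro j hj
        by_cases hcj : c j = 0
        · simp [hcj]
        · filter_upwards [hs j hj hcj] with x hx hxI
          linear_combination c j * hx hxI
      filter_upwards [hall, hc] with x k1 k2 hx
      have k2 := k2 hx
      rw [Finset.sum_insert hm, mul_add, Finset.mul_sum,
        Finset.sum_eq_zero fun j hj => k1 j hj hx, add_zero] at k2
      have : c i * ((r x : ℂ) * y i x) = 0 := by linear_combination k2
      exact (mul_eq_zero.mp this).resolve_left hci
    · exact hs i hi' hci

theorem exists_nodes {a b : ℝ} (hab : a < b) {k : ℝ → ℝ} (hk : IntervalIntegrable k volume a b) :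
    ∃ (N : ℕ) (x : ℕ → ℝ), Monotone x ∧ x 0 = a ∧ x N = b ∧
      ∀ i < N, ∫ t in (x i)..(x (i + 1)), k t ≤ 1 / 2 := by
  have hK := hk.absolutelyContinuousOnInterval_intervalIntegral (c := a) (by simp)
  have hu := hK.uniformContinuousOn
  rw [Set.uIcc_of_le hab.le, Metric.uniformContinuousOn_iff] at hu
  obtain ⟨δ, hδ, H⟩ := hu (1 / 2) (by norm_num)
  obtain ⟨n, hn⟩ := exists_nat_gt ((b - a) / δ)
  have hba : 0 < b - a := by linarith
  have hn0 : (0:ℝ) < n := lt_trans (by positivity) hn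
  have hstep : (b - a) / n < δ := by
    rw [div_lt_iff₀ hδ] at hn
    rw [div_lt_iff₀ hn0]; linarith
  have hst0 : 0 ≤ (b - a) / n := by positivity
  have hmono : Monotone (fun i : ℕ => a + i * ((b - a) / n)) := by
    intro i j hij
    have : (i:ℝ) ≤ j := by exact_mod_cast hij
    simp only
    gcongr
  have hend : a + n * ((b - a) / n) = b := by field_simp; ring
  refine ⟨n, fun i => a + i * ((b - a) / n), hmono, by simp, hend, fun i hi => ?_⟩
  have m1 : ∀ i ≤ n, a + i * ((b - a) / n) ∈ Set.Icc a b := by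
    intro i hi
    constructor
    · have := hmono (Nat.zero_le i); simpa using this
    · have := hmono hi; simp only at this; rwa [hend] at this
  have hI : ∀ x ∈ Set.Icc a b, IntervalIntegrable k volume a x := fun x hx =>
    hk.mono_set (by rw [Set.uIcc_of_le hx.1, Set.uIcc_of_le (hx.1.trans hx.2)]
                    exact Set.Icc_subset_Icc_right hx.2)
  have A := m1 i hi.le
  have B := m1 (i+1) hi
  have := H _ B _ A (by
    rw [Real.dist_eq]; push_cast
    rw [show a + (i + 1) * ((b - a) / n) - (a + i * ((b - a) / n)) = (b - a) / n by ring,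
      abs_of_nonneg hst0]
    exact hstep)
  rw [Real.dist_eq, intervalIntegral.integral_interval_sub_left (hI _ B) (hI _ A)] at this
  exact (le_abs_self _).trans this.le

theorem piece {s t : ℝ} (hst : s ≤ t) {u v : ℝ → ℂ} {p Q : ℝ → ℝ}
    (hu : Prm s t (fun x => v x / (p x : ℂ)) u) (hv : ContinuousOn v (Set.Icc s t)) (hus : u s = 0)
    (hp : ∀ᵐ x, x ∈ Set.Icc s t → 0 < p x)
    (hip : IntervalIntegrable (fun x => (p x)⁻¹) volume s t)
    (hQ : IntervalIntegrable Q volume s t)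
    (hsm : ∫ x in s..t, ((p x)⁻¹ + |Q x|) ≤ 1 / 2) {x : ℝ} (hx : x ∈ Set.Icc s t) :
    ‖u x‖ ^ 2 ≤ ∫ x in s..t, ((p x)⁻¹ * ‖v x‖ ^ 2 + Q x * ‖u x‖ ^ 2) := by
  have hvn : ContinuousOn (fun x => ‖v x‖) (Set.uIcc s t) := by
    rw [Set.uIcc_of_le hst]; exact hv.norm
  have hun : ContinuousOn (fun x => ‖u x‖) (Set.uIcc s t) := by
    rw [Set.uIcc_of_le hst]; exact (hu.cont hst).norm
  have hp' : ∀ᵐ x ∂(volume.restrict (Set.Icc s t)), 0 < p x :=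
    (ae_restrict_iff' measurableSet_Icc).mpr hp
  have i1 : IntervalIntegrable (fun x => (p x)⁻¹ * ‖v x‖) volume s t := hip.mul_continuousOn hvn
  have i2 : IntervalIntegrable (fun x => (p x)⁻¹ * ‖v x‖ ^ 2) volume s t :=
    hip.mul_continuousOn (hvn.pow 2)
  have i3 : IntervalIntegrable (fun x => Q x * ‖u x‖ ^ 2) volume s t :=
    hQ.mul_continuousOn (hun.pow 2)
  set A := ∫ x in s..t, (p x)⁻¹ * ‖v x‖ with hA
  have hle : ∀ x ∈ Set.Icc s t, ‖u x‖ ≤ A := by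
    intro x hx
    rw [hu.eq x hx, hus, zero_add]
    refine (intervalIntegral.norm_integral_le_integral_norm hx.1).trans ?_
    have hs2 : Set.Icc s x ⊆ Set.Icc s t := Set.Icc_subset_Icc_right hx.2
    have e : ∫ y in s..x, ‖v y / (p y : ℂ)‖ = ∫ y in s..x, (p y)⁻¹ * ‖v y‖ := by
      apply intervalIntegral.integral_congr_ae
      filter_upwards [hp] with y hy hyI
      rw [Set.uIoc_of_le hx.1] at hyI
      have := hy ⟨hyI.1.le, hyI.2.trans hx.2⟩
      rw [norm_div, Complex.norm_real, Real.norm_of_nonneg this.le]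
      field_simp
    rw [e]
    apply intervalIntegral.integral_mono_interval le_rfl hx.1 hx.2 _ i1
    have : ∀ᵐ x ∂(volume.restrict (Set.Ioc s t)), 0 < p x :=
      ae_mono (Measure.restrict_mono Set.Ioc_subset_Icc_self le_rfl) hp'
    filter_upwards [this] with y hy
    show (0:ℝ) ≤ _
    positivity
  have hA0 : 0 ≤ A := (norm_nonneg _).trans (hle x hx)
  have hP0 : 0 ≤ ∫ x in s..t, (p x)⁻¹ := by
    apply intervalIntegral.integral_nonneg_of_ae_restrict hst
    filter_upwards [hp'] with y hy
    show (0:ℝ) ≤ _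
    positivity
  have hR0 : 0 ≤ ∫ x in s..t, |Q x| :=
    intervalIntegral.integral_nonneg hst fun _ _ => abs_nonneg _
  rw [intervalIntegral.integral_add hip hQ.abs] at hsm
  rw [intervalIntegral.integral_add i2 i3]
  have hsq : 0 ≤ ∫ x in s..t, ((p x)⁻¹ * ‖v x‖ ^ 2 - (4 * A) * ((p x)⁻¹ * ‖v x‖)
      + (4 * A ^ 2) * (p x)⁻¹) := by
    apply intervalIntegral.integral_nonneg_of_ae_restrict hst
    filter_upwards [hp'] with y hy
    have : (p y)⁻¹ * ‖v y‖ ^ 2 - (4 * A) * ((p y)⁻¹ * ‖v y‖) + (4 * A ^ 2) * (p y)⁻¹ =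
      (p y)⁻¹ * (‖v y‖ - 2 * A) ^ 2 := by ring
    show (0:ℝ) ≤ _
    rw [this]
    positivity
  rw [intervalIntegral.integral_add (i2.sub (i1.const_mul _)) (hip.const_mul _),
    intervalIntegral.integral_sub i2 (i1.const_mul _), intervalIntegral.integral_const_mul,
    intervalIntegral.integral_const_mul, ← hA] at hsq
  have hlow : ∫ x in s..t, (-A ^ 2) * |Q x| ≤ ∫ x in s..t, Q x * ‖u x‖ ^ 2 := by
    apply intervalIntegral.integral_mono_on hst (hQ.abs.const_mul _) i3
    intro y hy
    have h1 := hle y hy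
    have h2 : ‖u y‖ ^ 2 ≤ A ^ 2 := by gcongr
    have h3 := neg_abs_le (Q y)
    have h4 : |Q y| * ‖u y‖ ^ 2 ≤ |Q y| * A ^ 2 := by gcongr
    nlinarith [sq_nonneg ‖u y‖]
  rw [intervalIntegral.integral_const_mul] at hlow
  have h2 : ‖u x‖ ^ 2 ≤ A ^ 2 := by have := hle x hx; gcongr
  have h3 : A ^ 2 * (∫ x in s..t, (p x)⁻¹) + A ^ 2 * (∫ x in s..t, |Q x|) ≤ A ^ 2 * (1 / 2) := by
    rw [← mul_add]; gcongr
  have h4 : 0 ≤ A ^ 2 * (∫ x in s..t, (p x)⁻¹) := by positivity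
  have h5 : 0 ≤ A ^ 2 * (∫ x in s..t, |Q x|) := by positivity
  nlinarith


theorem det_zero {c s y v w z : ℂ} (h : c ^ 2 + s ^ 2 = 1) (h1 : y * c - v * s = 0)
    (h2 : w * c - z * s = 0) : w * v - z * y = 0 := by
  have e1 : (w * v - z * y) * c = 0 := by linear_combination v * h2 - z * h1
  have e2 : (w * v - z * y) * s = 0 := by linear_combination -w * h1 + y * h2
  linear_combination c * e1 + s * e2 - (w * v - z * y) * h

theorem sl_orth {p q r : ℝ → ℝ} {a b : ℝ} (hab : a ≤ b) {α β : ℝ} {l m : ℂ} {y py w pw : ℝ → ℂ}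
    (h1 : Prm a b (fun t => py t / (p t : ℂ)) y)
    (h2 : Prm a b (fun t => (q t : ℂ) * y t - l * (r t : ℂ) * y t) py)
    (k1 : Prm a b (fun t => pw t / (p t : ℂ)) w)
    (k2 : Prm a b (fun t => (q t : ℂ) * w t - m * (r t : ℂ) * w t) pw)
    (ha : y a * (Real.cos α : ℂ) - py a * (Real.sin α : ℂ) = 0)
    (hb : y b * (Real.cos β : ℂ) + py b * (Real.sin β : ℂ) = 0)
    (ka : w a * (Real.cos α : ℂ) - pw a * (Real.sin α : ℂ) = 0)
    (kb : w b * (Real.cos β : ℂ) + pw b * (Real.sin β : ℂ) = 0)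
    (hlm : l ≠ (starRingEnd ℂ) m) :
    ∫ x in a..b, (r x : ℂ) * ((starRingEnd ℂ) (w x) * y x) = 0 := by
  have A := Prm.mul hab k1.conj h2
  have B := Prm.mul hab k2.conj h1
  have eA := A.eq b ⟨hab, le_rfl⟩
  have eB := B.eq b ⟨hab, le_rfl⟩
  have cs : ∀ θ : ℝ, (Real.cos θ : ℂ) ^ 2 + (Real.sin θ : ℂ) ^ 2 = 1 := by
    intro θ; exact_mod_cast Real.cos_sq_add_sin_sq θ
  have da : (starRingEnd ℂ) (w a) * py a - (starRingEnd ℂ) (pw a) * y a = 0 := by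
    refine det_zero (cs α) ha ?_
    have := congrArg (starRingEnd ℂ) ka
    simpa [-Complex.ofReal_cos, -Complex.ofReal_sin] using this
  have db : (starRingEnd ℂ) (w b) * py b - (starRingEnd ℂ) (pw b) * y b = 0 := by
    refine det_zero (c := (Real.cos β : ℂ)) (s := -(Real.sin β : ℂ)) (by rw [neg_sq]; exact cs β)
      (by linear_combination hb) ?_
    have := congrArg (starRingEnd ℂ) kb
    simp [-Complex.ofReal_cos, -Complex.ofReal_sin] at this
    linear_combination this
  have hs := intervalIntegral.integral_sub A.int B.int
  have e : ∀ x, ((starRingEnd ℂ) (pw x / (p x : ℂ)) * py x + (starRingEnd ℂ) (w x) *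
      ((q x : ℂ) * y x - l * (r x : ℂ) * y x)) -
      ((starRingEnd ℂ) ((q x : ℂ) * w x - m * (r x : ℂ) * w x) * y x +
        (starRingEnd ℂ) (pw x) * (py x / (p x : ℂ))) =
      ((starRingEnd ℂ) m - l) * ((r x : ℂ) * ((starRingEnd ℂ) (w x) * y x)) := by
    intro x
    simp only [map_div₀, map_sub, map_mul, Complex.conj_ofReal]
    ring
  simp_rw [e] at hs
  rw [intervalIntegral.integral_const_mul] at hs
  have : ((starRingEnd ℂ) m - l) * ∫ x in a..b, (r x : ℂ) * ((starRingEnd ℂ) (w x) * y x) = 0 := by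
    linear_combination hs - eA + eB + db - da
  exact (mul_eq_zero.mp this).resolve_left (sub_ne_zero.mpr hlm.symm)

theorem sl_finite_aux {p q r : ℝ → ℝ} {a b : ℝ} (hab : a < b)
    (hp : ∀ᵐ x, x ∈ Set.Icc a b → 0 < p x)
    (hq : IntegrableOn q (Set.Icc a b)) (hr : IntegrableOn r (Set.Icc a b))
    (hip : IntegrableOn (fun x => (p x)⁻¹) (Set.Icc a b))
    (hrnz : 0 < ∫ x in a..b, |r x|)
    {lam : ℕ → ℂ} {y py : ℕ → ℝ → ℂ}
    (hlam : Function.Injective lam)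
    (h1 : ∀ i, Prm a b (fun t => py i t / (p t : ℂ)) (y i))
    (h2 : ∀ i, Prm a b (fun t => (q t : ℂ) * y i t - lam i * (r t : ℂ) * y i t) (py i))
    (hne : ∀ i, ∃ x ∈ Set.Icc a b, y i x ≠ 0)
    (horth : ∀ i j, i ≠ j → ∫ x in a..b, (r x : ℂ) * ((starRingEnd ℂ) (y j x) * y i x) = 0)
    (z : ℝ)
    (hdiag : ∀ i, ((lam i - z) * ∫ x in a..b, (r x : ℂ) * ((starRingEnd ℂ) (y i x) * y i x)).re ≤ 0) :
    False := by
  have hip' : IntervalIntegrable (fun x => (p x)⁻¹) volume a b :=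
    (intervalIntegrable_iff_integrableOn_Icc_of_le hab.le).mpr hip
  have hr' : IntervalIntegrable r volume a b :=
    (intervalIntegrable_iff_integrableOn_Icc_of_le hab.le).mpr hr
  have hq' : IntervalIntegrable q volume a b :=
    (intervalIntegrable_iff_integrableOn_Icc_of_le hab.le).mpr hq
  set Q : ℝ → ℝ := fun x => q x - z * r x with hQdef
  have hQ : IntervalIntegrable Q volume a b := hq'.sub (hr'.const_mul z)
  obtain ⟨N, x, hmono, hx0, hxN, hsm⟩ := exists_nodes hab (hip'.add hQ.abs)
  have hxI : ∀ i ≤ N, x i ∈ Set.Icc a b := fun i hi =>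
    ⟨hx0 ▸ hmono (Nat.zero_le i), hxN ▸ hmono hi⟩
  -- a combination vanishing at the nodes
  obtain ⟨c, hcne, hc⟩ : ∃ c : ℕ → ℂ, (∃ i ∈ Finset.range (N + 2), c i ≠ 0) ∧
      ∀ j ≤ N, ∑ i ∈ Finset.range (N + 2), c i * y i (x j) = 0 := by
    let M : Matrix (Fin (N + 1)) (Fin (N + 2)) ℂ := fun j i => y i (x j)
    have hker : LinearMap.ker M.mulVecLin ≠ ⊥ :=
      LinearMap.ker_ne_bot_of_finrank_lt (by simp)
    obtain ⟨d, hd, hd0⟩ := (Submodule.ne_bot_iff _).mp hker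
    refine ⟨fun i => if h : i < N + 2 then d ⟨i, h⟩ else 0, ?_, ?_⟩
    · obtain ⟨i, hi⟩ := Function.ne_iff.mp hd0
      refine ⟨i, Finset.mem_range.mpr i.2, ?_⟩
      simpa using hi
    · intro j hj
      have := congrFun (LinearMap.mem_ker.mp hd) ⟨j, Nat.lt_succ_of_le hj⟩
      simp only [Matrix.mulVecLin_apply, Matrix.mulVec, dotProduct, Pi.zero_apply, M] at this
      rw [Finset.sum_range, ← this]
      refine Finset.sum_congr rfl fun i _ => ?_
      simp [mul_comm]
  set S := Finset.range (N + 2) with hS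
  set u : ℝ → ℂ := fun t => ∑ i ∈ S, c i * y i t with hu
  set v : ℝ → ℂ := fun t => ∑ i ∈ S, c i * py i t with hv
  have Pu : Prm a b (fun t => v t / (p t : ℂ)) u := by
    have := Prm.sum S c fun i _ => h1 i
    convert this using 2 with t
    rw [hv, Finset.sum_div]
    exact Finset.sum_congr rfl fun i _ => by ring
  have Pv := Prm.sum S c fun i _ => h2 i
  have cv : ContinuousOn v (Set.Icc a b) := Pv.cont hab.le
  have cu : ContinuousOn u (Set.Icc a b) := Pu.cont hab.le
  have hua : u a = 0 := by have := hc 0 (Nat.zero_le _); rwa [hx0] at this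
  have hub : u b = 0 := by have := hc N le_rfl; rwa [hxN] at this
  have cvn : ContinuousOn (fun x => ‖v x‖ ^ 2) (Set.uIcc a b) := by
    rw [Set.uIcc_of_le hab.le]; exact cv.norm.pow 2
  have cun : ContinuousOn (fun x => ‖u x‖ ^ 2) (Set.uIcc a b) := by
    rw [Set.uIcc_of_le hab.le]; exact cu.norm.pow 2
  have iE : IntervalIntegrable (fun x => (p x)⁻¹ * ‖v x‖ ^ 2 + Q x * ‖u x‖ ^ 2) volume a b :=
    (hip'.mul_continuousOn cvn).add (hQ.mul_continuousOn cun)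
  have iW : ∀ i j, IntervalIntegrable (fun x => (r x : ℂ) * ((starRingEnd ℂ) (y j x) * y i x))
      volume a b := by
    intro i j
    have : IntervalIntegrable (fun x => (r x : ℂ)) volume a b :=
      (intervalIntegrable_iff_integrableOn_Icc_of_le hab.le).mpr hr.ofReal
    refine this.mul_continuousOn ?_
    rw [Set.uIcc_of_le hab.le]
    exact ((h1 j).conj.cont hab.le).mul ((h1 i).cont hab.le)
  have hE : ∫ x in a..b, ((p x)⁻¹ * ‖v x‖ ^ 2 + Q x * ‖u x‖ ^ 2) ≤ 0 := by
    have A := (Prm.mul hab.le Pu.conj Pv).eq b ⟨hab.le, le_rfl⟩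
    simp only [hua, hub, map_zero, zero_mul, zero_add] at A
    have e : ∀ t, (starRingEnd ℂ) (v t / (p t : ℂ)) * (∑ i ∈ S, c i * py i t) +
        (starRingEnd ℂ) (u t) *
          ∑ i ∈ S, c i * ((q t : ℂ) * y i t - lam i * (r t : ℂ) * y i t) =
        (((p t)⁻¹ * ‖v t‖ ^ 2 + Q t * ‖u t‖ ^ 2 : ℝ) : ℂ) -
        ∑ i ∈ S, ∑ j ∈ S, (((starRingEnd ℂ) (c j) * c i * (lam i - z)) *
          ((r t : ℂ) * ((starRingEnd ℂ) (y j t) * y i t))) := by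
      intro t
      have e1 : (starRingEnd ℂ) (v t / (p t : ℂ)) * (∑ i ∈ S, c i * py i t) =
          ((p t : ℂ))⁻¹ * (‖v t‖ : ℂ) ^ 2 := by
        rw [← Complex.conj_mul', map_div₀, Complex.conj_ofReal]
        show (starRingEnd ℂ) (v t) / _ * v t = _
        ring
      have e2 : ∑ i ∈ S, c i * ((q t : ℂ) * y i t - lam i * (r t : ℂ) * y i t) =
          ((q t : ℂ) - z * r t) * u t - r t * ∑ i ∈ S, c i * (lam i - z) * y i t := by
        rw [hu, Finset.mul_sum, Finset.mul_sum, ← Finset.sum_sub_distrib]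
        exact Finset.sum_congr rfl fun i _ => by ring
      have e3 : ∑ i ∈ S, ∑ j ∈ S, (((starRingEnd ℂ) (c j) * c i * (lam i - z)) *
          ((r t : ℂ) * ((starRingEnd ℂ) (y j t) * y i t))) =
          (starRingEnd ℂ) (u t) * (r t * ∑ i ∈ S, c i * (lam i - z) * y i t) := by
        rw [hu]
        simp only [map_sum, map_mul]
        rw [Finset.mul_sum, Finset.sum_mul_sum, Finset.sum_comm]
        exact Finset.sum_congr rfl fun i _ => Finset.sum_congr rfl fun j _ => by ring
      rw [e1, e2, e3]
      push_cast
      rw [← Complex.conj_mul' (u t)]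
      simp only [hQdef]
      push_cast
      ring
    simp_rw [e] at A
    have iS : IntervalIntegrable (fun t => ∑ i ∈ S, ∑ j ∈ S,
        (((starRingEnd ℂ) (c j) * c i * (lam i - z)) *
          ((r t : ℂ) * ((starRingEnd ℂ) (y j t) * y i t)))) volume a b := by
      have : IntervalIntegrable (∑ i ∈ S, ∑ j ∈ S, fun t =>
        (((starRingEnd ℂ) (c j) * c i * (lam i - z)) *
          ((r t : ℂ) * ((starRingEnd ℂ) (y j t) * y i t)))) volume a b :=
        IntervalIntegrable.sum S fun i _ => IntervalIntegrable.sum S fun j _ => (iW i j).const_mul _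
      have e : (fun t => ∑ i ∈ S, ∑ j ∈ S,
        (((starRingEnd ℂ) (c j) * c i * (lam i - z)) *
          ((r t : ℂ) * ((starRingEnd ℂ) (y j t) * y i t)))) = (∑ i ∈ S, ∑ j ∈ S, fun t =>
        (((starRingEnd ℂ) (c j) * c i * (lam i - z)) *
          ((r t : ℂ) * ((starRingEnd ℂ) (y j t) * y i t)))) := by
        ext t; simp
      rw [e]; exact this
    have iEC : IntervalIntegrable (fun x => (((p x)⁻¹ * ‖v x‖ ^ 2 + Q x * ‖u x‖ ^ 2 : ℝ) : ℂ))
        volume a b := by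
      rw [intervalIntegrable_iff_integrableOn_Icc_of_le hab.le] at iE ⊢
      exact iE.ofReal
    rw [intervalIntegral.integral_sub iEC iS, intervalIntegral.integral_ofReal] at A
    have eS : (∫ t in a..b, ∑ i ∈ S, ∑ j ∈ S,
        (((starRingEnd ℂ) (c j) * c i * (lam i - z)) *
          ((r t : ℂ) * ((starRingEnd ℂ) (y j t) * y i t)))) =
        ∑ i ∈ S, ((‖c i‖ ^ 2 : ℝ) : ℂ) * ((lam i - z) *
          ∫ x in a..b, (r x : ℂ) * ((starRingEnd ℂ) (y i x) * y i x)) := by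
      have inner_int : ∀ i ∈ S, IntervalIntegrable (fun t => ∑ j ∈ S,
        (((starRingEnd ℂ) (c j) * c i * (lam i - z)) *
          ((r t : ℂ) * ((starRingEnd ℂ) (y j t) * y i t)))) volume a b := by
        intro i _
        have : IntervalIntegrable (∑ j ∈ S, fun t =>
          (((starRingEnd ℂ) (c j) * c i * (lam i - z)) *
          ((r t : ℂ) * ((starRingEnd ℂ) (y j t) * y i t)))) volume a b :=
          IntervalIntegrable.sum S fun j _ => (iW i j).const_mul _
        have e : (fun t => ∑ j ∈ S, (((starRingEnd ℂ) (c j) * c i * (lam i - z)) *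
          ((r t : ℂ) * ((starRingEnd ℂ) (y j t) * y i t)))) = (∑ j ∈ S, fun t =>
          (((starRingEnd ℂ) (c j) * c i * (lam i - z)) *
          ((r t : ℂ) * ((starRingEnd ℂ) (y j t) * y i t)))) := by
          ext t; simp
        rw [e]; exact this
      rw [intervalIntegral.integral_finsetSum inner_int]
      refine Finset.sum_congr rfl fun i hi => ?_
      rw [intervalIntegral.integral_finsetSum fun j _ => (iW i j).const_mul _]
      rw [Finset.sum_eq_single i]
      · rw [intervalIntegral.integral_const_mul, Complex.conj_mul']
        push_cast
        ring
      · intro j _ hji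
        rw [intervalIntegral.integral_const_mul, horth i j hji.symm, mul_zero]
      · intro h; exact absurd hi h
    rw [eS] at A
    have A' := congrArg Complex.re (sub_eq_zero.mp A.symm)
    rw [Complex.ofReal_re, Complex.re_sum] at A'
    rw [A']
    refine Finset.sum_nonpos fun i _ => ?_
    rw [Complex.re_ofReal_mul]
    exact mul_nonpos_of_nonneg_of_nonpos (by positivity) (hdiag i)
  -- pieces
  have sub1 : ∀ i < N, Set.uIcc (x i) (x (i + 1)) ⊆ Set.uIcc a b := by
    intro i hi
    rw [Set.uIcc_of_le (hmono (Nat.le_succ i)), Set.uIcc_of_le hab.le]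
    exact Set.Icc_subset_Icc (hxI i hi.le).1 (hxI (i+1) hi).2
  have hpiece : ∀ i < N, ∀ t ∈ Set.Icc (x i) (x (i + 1)), ‖u t‖ ^ 2 ≤
      ∫ x in (x i)..(x (i + 1)), ((p x)⁻¹ * ‖v x‖ ^ 2 + Q x * ‖u x‖ ^ 2) := by
    intro i hi t ht
    have hle := hmono (Nat.le_succ i)
    have hss : Set.Icc (x i) (x (i + 1)) ⊆ Set.Icc a b :=
      Set.Icc_subset_Icc (hxI i hi.le).1 (hxI (i+1) hi).2
    refine piece hle (Pu.mono (hxI i hi.le).1 hle (hxI (i+1) hi).2) (cv.mono hss) (hc i hi.le) ?_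
      (hip'.mono_set (sub1 i hi)) (hQ.mono_set (sub1 i hi)) (hsm i hi) ht
    filter_upwards [hp] with s hs hsI using hs (hss hsI)
  have hsum := intervalIntegral.sum_integral_adjacent_intervals (n := N) (a := x)
    (f := fun x => (p x)⁻¹ * ‖v x‖ ^ 2 + Q x * ‖u x‖ ^ 2) (μ := volume)
    (fun i hi => iE.mono_set (sub1 i hi))
  rw [hx0, hxN] at hsum
  have hpn : ∀ i ∈ Finset.range N, 0 ≤
      ∫ x in (x i)..(x (i + 1)), ((p x)⁻¹ * ‖v x‖ ^ 2 + Q x * ‖u x‖ ^ 2) := fun i hi =>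
    (sq_nonneg _).trans (hpiece i (Finset.mem_range.mp hi) (x i) ⟨le_rfl, hmono (Nat.le_succ i)⟩)
  have hz : ∀ i < N, ∀ t ∈ Set.Icc (x i) (x (i + 1)), u t = 0 := by
    intro i hi t ht
    have k1 := Finset.single_le_sum hpn (Finset.mem_range.mpr hi)
    have k2 := hpiece i hi t ht
    have k3 : ‖u t‖ ^ 2 ≤ 0 := by linarith
    have k4 : ‖u t‖ = 0 := by
      have := sq_nonneg ‖u t‖
      exact pow_eq_zero_iff (two_ne_zero) |>.mp (le_antisymm k3 this)
    exact norm_eq_zero.mp k4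
  have hz' : ∀ i ≤ N, ∀ t ∈ Set.Icc a (x i), u t = 0 := by
    intro i
    induction i with
    | zero => intro _ t ht
              rw [hx0] at ht
              rw [le_antisymm ht.2 ht.1]; exact hua
    | succ i ih =>
      intro hi t ht
      rcases le_total t (x i) with h | h
      · exact ih (by omega) t ⟨ht.1, h⟩
      · exact hz i (by omega) t ⟨h, ht.2⟩
  have huz : ∀ t ∈ Set.Icc a b, u t = 0 := by
    have := hz' N le_rfl
    rwa [hxN] at this
  obtain ⟨i, hi, hci⟩ := hcne
  have hry := sl_indep hab.le hp hlam h1 h2 S c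
    (Filter.Eventually.of_forall fun t ht => by
      have := huz t ht
      simp only [hu] at this
      rw [this, mul_zero]) i hi hci
  have hyn := sl_ae_ne hab.le hp hq hr hip (h1 i) (h2 i) (hne i)
  have hr0 : ∫ x in a..b, |r x| = ∫ x in a..b, (0:ℝ) := by
    apply intervalIntegral.integral_congr_ae
    filter_upwards [hry, hyn] with t k1 k2 ht
    rw [Set.uIoc_of_le hab.le] at ht
    have ht' : t ∈ Set.Icc a b := ⟨ht.1.le, ht.2⟩
    have := (mul_eq_zero.mp (k1 ht')).resolve_right (k2 ht')
    have : r t = 0 := by exact_mod_cast this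
    rw [this, abs_zero]
  rw [hr0] at hrnz
  simp at hrnz


theorem sl_finite_of_sign {p q r : ℝ → ℝ} {a b : ℝ} (hab : a < b)
    (hp : ∀ᵐ x, x ∈ Set.Icc a b → 0 < p x)
    (hq : IntegrableOn q (Set.Icc a b)) (hr : IntegrableOn r (Set.Icc a b))
    (hip : IntegrableOn (fun x => (p x)⁻¹) (Set.Icc a b))
    (hrnz : 0 < ∫ x in a..b, |r x|) {α β : ℝ} {S : Set ℂ} {y py : ℂ → ℝ → ℂ}
    (hsol : ∀ l ∈ S, IsSLSolution p q r a b l (y l) (py l))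
    (hne : ∀ l ∈ S, ∃ x ∈ Set.Icc a b, y l x ≠ 0)
    (ha : ∀ l ∈ S, y l a * (Real.cos α : ℂ) - py l a * (Real.sin α : ℂ) = 0)
    (hb : ∀ l ∈ S, y l b * (Real.cos β : ℂ) + py l b * (Real.sin β : ℂ) = 0)
    (hconj : ∀ l ∈ S, ∀ m ∈ S, l ≠ m → l ≠ (starRingEnd ℂ) m) (z : ℝ)
    (hz : ∀ l ∈ S, (l.re - z) * ∫ x in a..b, r x * ‖y l x‖ ^ 2 ≤ 0) : S.Finite := by
  by_contra hinf
  have hinf : S.Infinite := hinf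
  let e := hinf.natEmbedding
  have reg := fun i => sl_regular hab.le hq hr hip (hsol (e i) (e i).2)
  refine sl_finite_aux hab hp hq hr hip hrnz (lam := fun i => (e i : ℂ))
    (y := fun i => y (e i)) (py := fun i => py (e i))
    (fun i j h => e.injective (Subtype.ext h)) (fun i => (reg i).1) (fun i => (reg i).2)
    (fun i => hne _ (e i).2) ?_ z ?_
  · intro i j hij
    refine sl_orth hab.le (reg i).1 (reg i).2 (reg j).1 (reg j).2 (ha _ (e i).2) (hb _ (e i).2)
      (ha _ (e j).2) (hb _ (e j).2) (hconj _ (e i).2 _ (e j).2 ?_)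
    intro h
    exact hij (e.injective (Subtype.ext h))
  · intro i
    have : (∫ x in a..b, (r x : ℂ) * ((starRingEnd ℂ) (y (e i) x) * y (e i) x)) =
        ((∫ x in a..b, r x * ‖y (e i) x‖ ^ 2 : ℝ) : ℂ) := by
      rw [← intervalIntegral.integral_ofReal]
      congr 1
      ext x
      rw [Complex.conj_mul']
      push_cast
      rfl
    simp only [this]
    have h := hz _ (e i).2
    rw [Complex.re_mul_ofReal]
    simpa using h

theorem sl_finite {p q r : ℝ → ℝ} {a b : ℝ} (hab : a < b)
    (hp : ∀ᵐ x, x ∈ Set.Icc a b → 0 < p x)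
    (hq : IntegrableOn q (Set.Icc a b)) (hr : IntegrableOn r (Set.Icc a b))
    (hip : IntegrableOn (fun x => (p x)⁻¹) (Set.Icc a b))
    (hrnz : 0 < ∫ x in a..b, |r x|) (α β : ℝ) (R : ℝ) :
    {l : ℂ | IsEigenvalue p q r a b α β l ∧ ‖l‖ ≤ R}.Finite := by
  classical
  have hex : ∀ l : ℂ, ∃ w : (ℝ → ℂ) × (ℝ → ℂ), IsEigenvalue p q r a b α β l →
      IsSLSolution p q r a b l w.1 w.2 ∧ (∃ x ∈ Set.Icc a b, w.1 x ≠ 0) ∧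
      w.1 a * (Real.cos α : ℂ) - w.2 a * (Real.sin α : ℂ) = 0 ∧
      w.1 b * (Real.cos β : ℂ) + w.2 b * (Real.sin β : ℂ) = 0 := by
    intro l
    by_cases h : IsEigenvalue p q r a b α β l
    · obtain ⟨y, py, h⟩ := h
      exact ⟨(y, py), fun _ => h⟩
    · exact ⟨(0, 0), fun h' => absurd h' h⟩
  choose w hw using hex
  let s : ℂ → ℝ := fun l => ∫ x in a..b, r x * ‖(w l).1 x‖ ^ 2
  let T : Set ℂ := {l : ℂ | IsEigenvalue p q r a b α β l ∧ ‖l‖ ≤ R}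
  have key : ∀ S : Set ℂ, S ⊆ T → ((∀ l ∈ S, 0 ≤ l.im) ∨ (∀ l ∈ S, l.im ≤ 0)) →
      ((∀ l ∈ S, 0 ≤ s l) ∨ (∀ l ∈ S, s l ≤ 0)) → S.Finite := by
    intro S hS him hs
    have hre : ∀ l ∈ S, |l.re| ≤ R := fun l hl => (Complex.abs_re_le_norm l).trans (hS hl).2
    refine sl_finite_of_sign hab hp hq hr hip hrnz (α := α) (β := β)
      (y := fun l => (w l).1) (py := fun l => (w l).2)
      (fun l hl => (hw l (hS hl).1).1) (fun l hl => (hw l (hS hl).1).2.1)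
      (fun l hl => (hw l (hS hl).1).2.2.1) (fun l hl => (hw l (hS hl).1).2.2.2) ?_
      (if ∀ l ∈ S, 0 ≤ s l then R else -R) ?_
    · intro l hl m hm hlm h
      apply hlm
      have h1 := congrArg Complex.re h
      have h2 := congrArg Complex.im h
      simp only [Complex.conj_re, Complex.conj_im] at h1 h2
      refine Complex.ext h1 ?_
      rcases him with him | him
      · have := him l hl; have := him m hm; linarith
      · have := him l hl; have := him m hm; linarith
    · intro l hl
      have hl' := abs_le.mp (hre l hl)
      split_ifs with hc
      · exact mul_nonpos_of_nonpos_of_nonneg (by linarith) (hc l hl)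
      · have hs' := hs.resolve_left hc
        exact mul_nonpos_of_nonneg_of_nonpos (by linarith) (hs' l hl)
  have f1 := key {l ∈ T | 0 ≤ l.im ∧ 0 ≤ s l} (fun l hl => hl.1)
    (Or.inl fun l hl => hl.2.1) (Or.inl fun l hl => hl.2.2)
  have f2 := key {l ∈ T | 0 ≤ l.im ∧ s l ≤ 0} (fun l hl => hl.1)
    (Or.inl fun l hl => hl.2.1) (Or.inr fun l hl => hl.2.2)
  have f3 := key {l ∈ T | l.im ≤ 0 ∧ 0 ≤ s l} (fun l hl => hl.1)
    (Or.inr fun l hl => hl.2.1) (Or.inl fun l hl => hl.2.2)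
  have f4 := key {l ∈ T | l.im ≤ 0 ∧ s l ≤ 0} (fun l hl => hl.1)
    (Or.inr fun l hl => hl.2.1) (Or.inr fun l hl => hl.2.2)
  refine ((f1.union f2).union (f3.union f4)).subset ?_
  intro l hl
  rcases le_total 0 l.im with h | h <;> rcases le_total 0 (s l) with h' | h'
  · exact Or.inl (Or.inl ⟨hl, h, h'⟩)
  · exact Or.inl (Or.inr ⟨hl, h, h'⟩)
  · exact Or.inr (Or.inl ⟨hl, h, h'⟩)
  · exact Or.inr (Or.inr ⟨hl, h, h'⟩)


/-- Haupt's theorem: if `∫ |r| > 0` the characteristic function does not vanish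
identically, and consequently the eigenvalues form a discrete subset of `ℂ`
with no finite accumulation point. -/
theorem characteristic_function_not_identically_zero_and_spectrum_discrete
    (p q r : ℝ → ℝ) (a b : ℝ) (hab : a < b)
    (hp : ∀ᵐ x ∂(volume.restrict (Set.Icc a b)), 0 < p x)
    (hq : IntegrableOn q (Set.Icc a b))
    (hr : IntegrableOn r (Set.Icc a b))
    (hip : IntegrableOn (fun x => (p x)⁻¹) (Set.Icc a b))
    (hrnz : 0 < ∫ x in a..b, |r x|)
    (α β : ℝ) (hα : 0 ≤ α) (hα' : α < Real.pi) (hβ : 0 ≤ β) (hβ' : β < Real.pi)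
    (Y PY : ℂ → ℝ → ℂ)
    (hfam : ∀ l : ℂ, IsSLSolution p q r a b l (Y l) (PY l))
    (hinita : ∀ l : ℂ, Y l a = (Real.sin α : ℂ))
    (hinitb : ∀ l : ℂ, PY l a = (Real.cos α : ℂ)) :
    (∃ l : ℂ, Y l b * (Real.cos β : ℂ) + PY l b * (Real.sin β : ℂ) ≠ 0) ∧
    ∀ z : ℂ, ¬ AccPt z (Filter.principal {l : ℂ | IsEigenvalue p q r a b α β l}) := by
  have hp' : ∀ᵐ x, x ∈ Set.Icc a b → 0 < p x := (ae_restrict_iff' measurableSet_Icc).mp hp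
  have hfin := sl_finite hab hp' hq hr hip hrnz α β
  constructor
  · by_contra hcon
    push Not at hcon
    have hev : ∀ l, IsEigenvalue p q r a b α β l := by
      intro l
      refine ⟨Y l, PY l, hfam l, ?_, ?_, hcon l⟩
      · by_contra hz
        push Not at hz
        have haI : a ∈ Set.Icc a b := ⟨le_rfl, hab.le⟩
        have hsin : Real.sin α = 0 := by
          have h := hinita l
          rw [hz a haI] at h
          exact_mod_cast h.symm
        have hPY : ∀ x ∈ Set.Icc a b, PY l x = (Real.cos α : ℂ) := by
          intro x hx
          rw [(hfam l).2 x hx, hinitb l]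
          have : ∫ t in a..x, ((q t : ℂ) * Y l t - l * (r t : ℂ) * Y l t) = ∫ t in a..x, (0 : ℂ) := by
            refine intervalIntegral.integral_congr fun t ht => ?_
            rw [Set.uIcc_of_le hx.1] at ht
            simp [hz t ⟨ht.1, ht.2.trans hx.2⟩]
          rw [this]
          simp
        have hzero := (sl_regular hab.le hq hr hip (hfam l)).1.zero hab.le
        have hae : ∀ᵐ x, x ∈ Set.Icc a b → Real.cos α = 0 := by
          filter_upwards [hzero, hp'] with x hx hpx hxI
          have h := hx hxI (hz x hxI)
          rw [hPY x hxI, div_eq_zero_iff] at h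
          rcases h with h | h
          · exact_mod_cast h
          · have : p x = 0 := by exact_mod_cast h
            exact absurd this (hpx hxI).ne'
        have hcos : Real.cos α = 0 := by
          by_contra hne
          have hae' : ∀ᵐ x : ℝ, x ∉ Set.Icc a b := by
            filter_upwards [hae] with x hx hxI using hne (hx hxI)
          have h0 := measure_eq_zero_iff_ae_notMem.mpr hae'
          rw [Real.volume_Icc, ENNReal.ofReal_eq_zero] at h0
          linarith
        have := Real.sin_sq_add_cos_sq α
        rw [hsin, hcos] at this
        norm_num at this
      · rw [hinita, hinitb]
        ring
    have h1 := hfin 1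
    have h2 : (Metric.closedBall (0 : ℂ) 1).Finite := by
      refine h1.subset fun l hl => ⟨hev l, ?_⟩
      simpa using hl
    exact infinite_of_mem_nhds (0 : ℂ) (Metric.closedBall_mem_nhds 0 one_pos) h2
  · intro z hz
    have h := hz.nhds_inter (Metric.closedBall_mem_nhds z one_pos)
    have hf : (Metric.closedBall z 1 ∩ {l : ℂ | IsEigenvalue p q r a b α β l}).Finite := by
      refine (hfin (‖z‖ + 1)).subset fun l hl => ⟨hl.2, ?_⟩
      have h1 : ‖l - z‖ ≤ 1 := by simpa [dist_eq_norm] using hl.1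
      have h2 := norm_le_norm_add_norm_sub' l z
      linarith
    rw [accPt_iff_nhds] at h
    obtain ⟨y, hy, hyz⟩ := h _ ((hf.subset Set.sdiff_subset).isClosed.isOpen_compl.mem_nhds
      (show z ∈ ((Metric.closedBall z 1 ∩ {l : ℂ | IsEigenvalue p q r a b α β l}) \ {z})ᶜ by simp))
    exact hy.1 ⟨hy.2, hyz⟩
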